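/- Let 𝔤 = 𝒜₄,₃ be the 4-dimensional real Lie algebra with brackets [e₁,e₄] = e₁ and [e₃,e₄] = e₂. Then for every inner product g on 𝔤 and every alternating 2-form F on 𝔤 such that (g,F) is a solution of the Einstein–Maxwell equations, the metric g is Einstein. -/

import Mathlib

open scoped BigOperators

noncomputable section

/-- The underlying vector space `ℝ⁴` of the 4-dimensional Lie algebra. -/
abbrev V4 : Type := Fin 4 → ℝ

/-- The standard basis `e₁, e₂, e₃, e₄` (0-indexed). -/
def ee (i : Fin 4) : V4 := Pi.single i 1

/-- `g` is an inner product: a positive-definite symmetric bilinear form. -/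
structure IsInnerProduct (g : V4 → V4 → ℝ) : Prop where
  symm : ∀ x y, g x y = g y x
  add_left : ∀ x y z, g (x + y) z = g x z + g y z
  smul_left : ∀ (a : ℝ) (x y : V4), g (a • x) y = a * g x y
  pos : ∀ x : V4, x ≠ 0 → 0 < g x x

/-- `F` is an alternating bilinear 2-form. -/
structure IsAltForm (F : V4 → V4 → ℝ) : Prop where
  skew : ∀ x y, F x y = - F y x
  add_left : ∀ x y z, F (x + y) z = F x z + F y z
  smul_left : ∀ (a : ℝ) (x y : V4), F (a • x) y = a * F x y

/-- Chevalley–Eilenberg differential of a 2-form with respect to the bracket `br`: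
`dF(x,y,z) = −F([x,y],z) + F([x,z],y) − F([y,z],x)`. -/
def cdiff (br : V4 → V4 → V4) (F : V4 → V4 → ℝ) (x y z : V4) : ℝ :=
  - F (br x y) z + F (br x z) y - F (br y z) x

/-- A 2-form is closed if its Chevalley–Eilenberg differential vanishes. -/
def IsClosedForm (br : V4 → V4 → V4) (F : V4 → V4 → ℝ) : Prop :=
  ∀ x y z, cdiff br F x y z = 0

/-- The Gram matrix of a bilinear form in the standard basis. -/
def gram (g : V4 → V4 → ℝ) : Matrix (Fin 4) (Fin 4) ℝ :=
  Matrix.of fun i j => g (ee i) (ee j)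

/-- The inverse Gram matrix. -/
def ginv (g : V4 → V4 → ℝ) : Matrix (Fin 4) (Fin 4) ℝ := (gram g)⁻¹

/-- The inner product induced by `g` on 2-forms:
`⟨α,β⟩ = (1/2) Σ g^{ik} g^{jl} α_{ij} β_{kl}`. -/
def formInner (g : V4 → V4 → ℝ) (α β : V4 → V4 → ℝ) : ℝ :=
  (1 / 2) * ∑ i, ∑ j, ∑ k, ∑ l,
    ginv g i k * ginv g j l * α (ee i) (ee j) * β (ee k) (ee l)

/-- The volume form of `g` for the orientation `e¹∧e²∧e³∧e⁴`. -/
def vol (g : V4 → V4 → ℝ) (x y z w : V4) : ℝ :=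
  Real.sqrt (gram g).det * Matrix.det (Matrix.of fun i j => ![x, y, z, w] i j)

/-- The wedge product of two 2-forms, as a 4-form. -/
def wedge22 (α β : V4 → V4 → ℝ) (x y z w : V4) : ℝ :=
  α x y * β z w - α x z * β y w + α x w * β y z
    + α z w * β x y - α y w * β x z + α y z * β x w

/-- `sF` is the Hodge star `⋆F` of `F` with respect to `g` and the orientation
`e¹∧e²∧e³∧e⁴`: it is the 2-form with `α ∧ sF = ⟨α,F⟩_g vol_g` for all 2-forms `α`. -/
def IsHodgeStar (g : V4 → V4 → ℝ) (F sF : V4 → V4 → ℝ) : Prop :=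
  IsAltForm sF ∧
    ∀ α : V4 → V4 → ℝ, IsAltForm α → ∀ x y z w,
      wedge22 α sF x y z w = formInner g α F * vol g x y z w

/-- `F` is co-closed: `d(⋆F) = 0`. -/
def IsCoclosed (br : V4 → V4 → V4) (g F : V4 → V4 → ℝ) : Prop :=
  ∃ sF, IsHodgeStar g F sF ∧ IsClosedForm br sF

/-- Koszul expression: `g(∇ₓy, z) = (1/2)(g([x,y],z) − g([y,z],x) + g([z,x],y))`. -/
def koszul (br : V4 → V4 → V4) (g : V4 → V4 → ℝ) (x y z : V4) : ℝ :=
  (1 / 2) * (g (br x y) z - g (br y z) x + g (br z x) y)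

/-- The Levi-Civita product `∇ₓ y`, i.e. the unique vector with
`g(∇ₓy, z) = koszul x y z` for all `z` (computed via the inverse Gram matrix). -/
def LC (br : V4 → V4 → V4) (g : V4 → V4 → ℝ) (x y : V4) : V4 :=
  fun m => ∑ k, koszul br g x y (ee k) * ginv g k m

/-- Curvature `R(x,y)z = ∇ₓ∇_y z − ∇_y∇ₓ z − ∇_{[x,y]} z`. -/
def curv (br : V4 → V4 → V4) (g : V4 → V4 → ℝ) (x y z : V4) : V4 :=
  LC br g x (LC br g y z) - LC br g y (LC br g x z) - LC br g (br x y) z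

/-- Ricci tensor `Ric(x,y) = Σᵢ g(R(vᵢ,x)y, vᵢ)` for a `g`-orthonormal basis `(vᵢ)`,
i.e. the trace of the endomorphism `z ↦ R(z,x)y`. -/
def ricci (br : V4 → V4 → V4) (g : V4 → V4 → ℝ) (x y : V4) : ℝ :=
  ∑ i, curv br g (ee i) x y i

/-- Scalar curvature: the `g`-trace of the Ricci tensor. -/
def scal (br : V4 → V4 → V4) (g : V4 → V4 → ℝ) : ℝ :=
  ∑ a, ∑ b, ginv g a b * ricci br g (ee a) (ee b)

/-- Trace-free Ricci tensor `Ric₀ = Ric − (s/4) g`. -/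
def ricci0 (br : V4 → V4 → V4) (g : V4 → V4 → ℝ) (x y : V4) : ℝ :=
  ricci br g x y - (scal br g / 4) * g x y

/-- `g` is Einstein: `Ric₀ = 0`. -/
def IsEinstein (br : V4 → V4 → V4) (g : V4 → V4 → ℝ) : Prop :=
  ∀ x y, ricci0 br g x y = 0

/-- The endomorphism `F̂` with `g(F̂x, y) = F(x,y)` (computed via the inverse Gram matrix). -/
def fhat (g F : V4 → V4 → ℝ) (x : V4) : V4 :=
  fun m => ∑ k, F x (ee k) * ginv g k m

/-- `[F∘F]₀(x,y) = g(F̂(F̂x), y) − (1/4) tr(F̂∘F̂) g(x,y)`. -/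
def FF0 (g F : V4 → V4 → ℝ) (x y : V4) : ℝ :=
  g (fhat g F (fhat g F x)) y
    - (1 / 4) * (∑ i, fhat g F (fhat g F (ee i)) i) * g x y

/-- `(g, F)` is a solution of the Einstein--Maxwell equations:
`dF = 0`, `d(⋆F) = 0`, and `Ric₀ = −[F∘F]₀`. -/
def IsEMSolution (br : V4 → V4 → V4) (g F : V4 → V4 → ℝ) : Prop :=
  IsClosedForm br F ∧ IsCoclosed br g F ∧ ∀ x y, ricci0 br g x y = - FF0 g F x y

/-- Nijenhuis tensor `N_J(x,y) = [Jx,Jy] − J[Jx,y] − J[x,Jy] − [x,y]`. -/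
def nijenhuis (br : V4 → V4 → V4) (J : V4 →ₗ[ℝ] V4) (x y : V4) : V4 :=
  br (J x) (J y) - J (br (J x) y) - J (br x (J y)) - br x y

/-- The Lie algebra `𝒜₄,₃`: `[e₁,e₄] = e₁`, `[e₃,e₄] = e₂`. -/
def brA43 : V4 → V4 → V4 := fun x y =>
  (x 0 * y 3 - x 3 * y 0) • ee 0 + (x 2 * y 3 - x 3 * y 2) • ee 1

/-- A linear functional on `V4` commutes with finite linear combinations. -/
theorem map_sum_smul {f : V4 → ℝ} (hadd : ∀ x y, f (x + y) = f x + f y)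
    (hsmul : ∀ (a : ℝ) x, f (a • x) = a * f x) (c : Fin 4 → ℝ) (v : Fin 4 → V4) :
    f (∑ i, c i • v i) = ∑ i, c i * f (v i) := by
  simp only [Fin.sum_univ_four, hadd, hsmul]

theorem eq_sum_ee (x : V4) : x = ∑ i, x i • ee i := by
  ext j
  simp [ee, Finset.sum_apply, Pi.single_apply]

namespace IsInnerProduct

variable {g : V4 → V4 → ℝ}

theorem add_right (hg : IsInnerProduct g) (x y z : V4) : g x (y + z) = g x y + g x z := by
  rw [hg.symm, hg.add_left, hg.symm y, hg.symm z]

theorem smul_right (hg : IsInnerProduct g) (a : ℝ) (x y : V4) : g x (a • y) = a * g x y := by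
  rw [hg.symm, hg.smul_left, hg.symm]

theorem sub_left (hg : IsInnerProduct g) (x y z : V4) : g (x - y) z = g x z - g y z := by
  have := hg.add_left (x - y) y z
  rw [sub_add_cancel] at this
  linarith

end IsInnerProduct

namespace IsAltForm

variable {F : V4 → V4 → ℝ}

theorem add_right (hF : IsAltForm F) (x y z : V4) : F x (y + z) = F x y + F x z := by
  rw [hF.skew, hF.add_left, hF.skew x y, hF.skew x z]; ring

theorem smul_right (hF : IsAltForm F) (a : ℝ) (x y : V4) : F x (a • y) = a * F x y := by
  rw [hF.skew, hF.smul_left, hF.skew x y]; ring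

end IsAltForm

/-- `v` is a `g`-orthonormal frame. -/
def IsFrame (g : V4 → V4 → ℝ) (v : Fin 4 → V4) : Prop :=
  ∀ i j, g (v i) (v j) = if i = j then 1 else 0

namespace IsFrame

variable {g : V4 → V4 → ℝ} {v : Fin 4 → V4}

theorem mul_gram_mul (hg : IsInnerProduct g) (hv : IsFrame g v) :
    Matrix.of v * gram g * (Matrix.of v).transpose = 1 := by
  ext i j
  have h := hv i j
  rw [eq_sum_ee (v j), map_sum_smul (f := g (v i)) (hg.add_right _)
    (fun a x => hg.smul_right a _ x)] at h
  simp only [Matrix.mul_apply, Matrix.transpose_apply, Matrix.of_apply, gram, Matrix.one_apply]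
  rw [← h]
  refine Finset.sum_congr rfl fun k _ => ?_
  rw [mul_comm]
  congr 1
  conv_rhs => rw [eq_sum_ee (v i)]
  rw [map_sum_smul (f := fun x => g x (ee k)) (fun x y => hg.add_left x y _)
    (fun a x => hg.smul_left a x _)]

theorem ginv_eq (hg : IsInnerProduct g) (hv : IsFrame g v) :
    ginv g = (Matrix.of v).transpose * Matrix.of v := by
  refine Matrix.inv_eq_left_inv ?_
  rw [Matrix.mul_assoc]
  exact mul_eq_one_comm.mp (hv.mul_gram_mul hg)

theorem ginv_apply (hg : IsInnerProduct g) (hv : IsFrame g v) (k m : Fin 4) :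
    ginv g k m = ∑ a, v a k * v a m := by
  rw [hv.ginv_eq hg]
  simp [Matrix.mul_apply]

theorem det_mul_sqrt_ne_zero (hg : IsInnerProduct g) (hv : IsFrame g v) :
    Real.sqrt (gram g).det * (Matrix.of v).det ≠ 0 := by
  have h := congrArg Matrix.det (hv.mul_gram_mul hg)
  rw [Matrix.det_mul, Matrix.det_mul, Matrix.det_transpose, Matrix.det_one] at h
  have hd : (Matrix.of v).det ≠ 0 := by
    intro h0
    simp [h0] at h
  have hpos : 0 < (gram g).det := by
    have h2 : 0 < (Matrix.of v).det ^ 2 := by positivity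
    by_contra! hle
    nlinarith
  exact mul_ne_zero (Real.sqrt_pos.mpr hpos).ne' hd

/-- Raising an index: contracting a functional with the inverse metric. -/
theorem sum_mul_ginv (hg : IsInnerProduct g) (hv : IsFrame g v) {f : V4 → ℝ}
    (hadd : ∀ x y, f (x + y) = f x + f y) (hsmul : ∀ (a : ℝ) x, f (a • x) = a * f x) :
    (fun m => ∑ k, f (ee k) * ginv g k m) = ∑ a, f (v a) • v a := by
  ext m
  have h : ∀ a, f (v a) = ∑ k, v a k * f (ee k) := fun a => by
    conv_lhs => rw [eq_sum_ee (v a)]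
    exact map_sum_smul hadd hsmul _ _
  simp only [hv.ginv_apply hg, h, Finset.sum_apply, Pi.smul_apply, smul_eq_mul, Finset.mul_sum,
    Finset.sum_mul]
  rw [Finset.sum_comm]
  exact Finset.sum_congr rfl fun _ _ => Finset.sum_congr rfl fun _ _ => by ring

theorem apply_sum (hg : IsInnerProduct g) (hv : IsFrame g v) (c : Fin 4 → ℝ) (j : Fin 4) :
    g (∑ i, c i • v i) (v j) = c j := by
  rw [map_sum_smul (f := fun x => g x (v j)) (fun x y => hg.add_left x y _)
    (fun a x => hg.smul_left a x _)]
  simp [hv _ _]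

theorem eq_sum (hg : IsInnerProduct g) (hv : IsFrame g v) (x : V4) :
    x = ∑ a, g x (v a) • v a := by
  rw [← hv.sum_mul_ginv hg (hg.add_right x) (fun a y => hg.smul_right a x y)]
  have hunit : IsUnit (gram g).det := by
    refine isUnit_iff_ne_zero.mpr fun h0 => hv.det_mul_sqrt_ne_zero hg ?_
    simp [h0]
  have hmul : gram g * ginv g = 1 := Matrix.mul_nonsing_inv _ hunit
  ext m
  have h : ∀ k, g x (ee k) = ∑ i, x i * gram g i k := fun k => by
    conv_lhs => rw [eq_sum_ee x]
    exact map_sum_smul (f := fun x => g x (ee k)) (fun x y => hg.add_left x y _)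
      (fun a x => hg.smul_left a x _) _ _
  have hm : ∀ i, ∑ k, gram g i k * ginv g k m = if i = m then 1 else 0 := fun i => by
    rw [← Matrix.mul_apply, hmul, Matrix.one_apply]
  simp only [h, Finset.sum_mul]
  rw [Finset.sum_comm]
  simp only [mul_assoc, ← Finset.mul_sum, hm]
  simp

/-- The trace of an endomorphism, computed in an orthonormal frame. -/
theorem trace_eq (hg : IsInnerProduct g) (hv : IsFrame g v) (T : V4 →ₗ[ℝ] V4) :
    ∑ i, T (ee i) i = ∑ a, g (T (v a)) (v a) := by
  have h1 : ∀ i, T (ee i) i = ∑ a, g (T (ee i)) (v a) * v a i := fun i => by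
    conv_lhs => rw [hv.eq_sum hg (T (ee i))]
    simp
  have h2 : ∀ a, g (T (v a)) (v a) = ∑ i, v a i * g (T (ee i)) (v a) := fun a => by
    conv_lhs => enter [1]; rw [eq_sum_ee (v a)]
    exact map_sum_smul (f := fun x => g (T x) (v a))
      (fun x y => by rw [map_add, hg.add_left]) (fun c x => by rw [map_smul, hg.smul_left]) _ _
  simp only [h1, h2]
  rw [Finset.sum_comm]
  simp only [mul_comm]

theorem fhat_eq (hg : IsInnerProduct g) (hv : IsFrame g v) {F : V4 → V4 → ℝ} (hF : IsAltForm F)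
    (x : V4) : fhat g F x = ∑ a, F x (v a) • v a :=
  hv.sum_mul_ginv hg (hF.add_right x) fun a y => hF.smul_right a x y

theorem fhat_fhat (hg : IsInnerProduct g) (hv : IsFrame g v) {F : V4 → V4 → ℝ}
    (hF : IsAltForm F) (i : Fin 4) :
    g (fhat g F (fhat g F (v i))) (v i) = - ∑ a, F (v i) (v a) ^ 2 := by
  rw [hv.fhat_eq hg hF, hv.apply_sum hg, hv.fhat_eq hg hF,
    map_sum_smul (f := fun x => F x (v i)) (fun x y => hF.add_left x y _)
      (fun a x => hF.smul_left a x _), ← Finset.sum_neg_distrib]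
  refine Finset.sum_congr rfl fun a _ => ?_
  rw [hF.skew (v a) (v i)]
  ring

theorem formInner_eq (hg : IsInnerProduct g) (hv : IsFrame g v) {F α : V4 → V4 → ℝ}
    (hF : IsAltForm F) (hα : IsAltForm α) :
    formInner g α F = (1 / 2) * ∑ a, ∑ b, α (v a) (v b) * F (v a) (v b) := by
  have key : ∀ {B : V4 → V4 → ℝ}, IsAltForm B → ∀ a b,
      B (v a) (v b) = ∑ i, ∑ j, v a i * v b j * B (ee i) (ee j) := fun {B} hB a b => by
    conv_lhs => rw [eq_sum_ee (v a), eq_sum_ee (v b)]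
    rw [map_sum_smul (f := fun x => B x _) (fun x y => hB.add_left x y _)
      (fun a x => hB.smul_left a x _)]
    refine Finset.sum_congr rfl fun i _ => ?_
    rw [map_sum_smul (f := B _) (hB.add_right _) (fun a x => hB.smul_right a _ x),
      Finset.mul_sum]
    exact Finset.sum_congr rfl fun j _ => by ring
  unfold formInner
  congr 1
  simp only [key hα, key hF, hv.ginv_apply hg]
  simp only [Finset.sum_mul, Finset.mul_sum]
  let f : Fin 4 × Fin 4 × Fin 4 × Fin 4 → Fin 4 × Fin 4 → ℝ := fun p q =>
    v q.1 p.1 * v q.2 p.2.1 * α (ee p.1) (ee p.2.1) *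
      (v q.1 p.2.2.1 * v q.2 p.2.2.2 * F (ee p.2.2.1) (ee p.2.2.2))
  have h : ∑ p, ∑ q, f p q = ∑ q, ∑ p, f p q := Finset.sum_comm
  simp only [Fintype.sum_prod_type, f] at h
  calc _ = _ := ?_
    _ = _ := h
    _ = _ := ?_
  · refine Finset.sum_congr rfl fun i _ => Finset.sum_congr rfl fun j _ =>
      Finset.sum_congr rfl fun k _ => Finset.sum_congr rfl fun l _ => ?_
    rw [Finset.sum_comm]
    exact Finset.sum_congr rfl fun a _ => Finset.sum_congr rfl fun b _ => by ring
  · refine Finset.sum_congr rfl fun a _ => Finset.sum_congr rfl fun b _ => ?_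
    simp only [← Finset.mul_sum, ← Finset.sum_mul]

/-- The components of `F` in an orthonormal frame, expressed through its Hodge star. -/
theorem star_apply (hg : IsInnerProduct g) (hv : IsFrame g v) {F sF : V4 → V4 → ℝ}
    (hF : IsAltForm F) (hs : IsHodgeStar g F sF) (p q : Fin 4) :
    wedge22 (fun x y => g x (v p) * g y (v q) - g x (v q) * g y (v p)) sF (v 0) (v 1) (v 2) (v 3) =
      F (v p) (v q) * (Real.sqrt (gram g).det * (Matrix.of v).det) := by
  have hα : IsAltForm (fun x y => g x (v p) * g y (v q) - g x (v q) * g y (v p)) :=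
    ⟨fun x y => by ring, fun x y z => by simp only [hg.add_left]; ring,
      fun a x y => by simp only [hg.smul_left]; ring⟩
  have hvol : vol g (v 0) (v 1) (v 2) (v 3) = Real.sqrt (gram g).det * (Matrix.of v).det := by
    unfold vol
    congr 2
    ext i j
    fin_cases i <;> rfl
  rw [hs.2 _ hα, hvol, hv.formInner_eq hg hF hα]
  congr 1
  simp only [hv _ _, sub_mul, Finset.sum_sub_distrib, ite_mul, mul_ite, one_mul, zero_mul, mul_one,
    mul_zero, Finset.sum_ite_eq', Finset.mem_univ, if_true]
  simp
  rw [hF.skew (v q) (v p)]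
  ring

end IsFrame

/-- One step of the Gram-Schmidt process starting from the basis vector `ee k`; some of the
`w i` may vanish. -/
theorem exists_gram_schmidt_step {g : V4 → V4 → ℝ} (hg : IsInnerProduct g) (w : Fin 3 → V4)
    (hw : ∀ i j, i ≠ j → g (w i) (w j) = 0) (hw1 : ∀ i, g (w i) (w i) = 1 ∨ w i = 0)
    (k : Fin 4) (hk : ∀ i, w i k = 0) :
    ∃ v : V4, g v v = 1 ∧ (∀ i, g v (w i) = 0) ∧ v k ≠ 0 ∧
      ∀ l, l ≠ k → (∀ i, w i l = 0) → v l = 0 := by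
  have hzero : ∀ x, g x 0 = 0 := fun x => by simpa using hg.smul_right 0 x 0
  set y : V4 := ee k - (g (ee k) (w 0) • w 0 + g (ee k) (w 1) • w 1 + g (ee k) (w 2) • w 2)
    with hy
  have hyk : y k = 1 := by simp [hy, hk, ee]
  have hpos : 0 < g y y := hg.pos y fun h => by simp [h] at hyk
  have hyw : ∀ i, g y (w i) = 0 := fun i => by
    have h01 := hw 0 1 (by decide)
    have h02 := hw 0 2 (by decide)
    have h12 := hw 1 2 (by decide)
    have h10 := hw 1 0 (by decide)
    have h20 := hw 2 0 (by decide)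
    have h21 := hw 2 1 (by decide)
    rcases hw1 i with h | h
    · fin_cases i <;> simp_all [hg.sub_left, hg.add_left, hg.smul_left]
    · rw [h, hzero]
  have hsq : (Real.sqrt (g y y))⁻¹ ≠ 0 := inv_ne_zero (Real.sqrt_pos.mpr hpos).ne'
  refine ⟨(Real.sqrt (g y y))⁻¹ • y, ?_, fun i => ?_, ?_, fun l hl h => ?_⟩
  · rw [hg.smul_left, hg.smul_right, ← mul_assoc, ← mul_inv, Real.mul_self_sqrt hpos.le,
      inv_mul_cancel₀ hpos.ne']
  · rw [hg.smul_left, hyw, mul_zero]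
  · simpa [hyk] using hsq
  · simp [hy, h, ee, hl]

/-- The matrix of the derivation `x ↦ [x, v 3]` in an adapted frame. -/
def derivMatrix (k r s t : ℝ) : Matrix (Fin 4) (Fin 4) ℝ :=
  !![k, 0, 0, 0; r, 0, 0, 0; s, t, 0, 0; 0, 0, 0, 0]

/-- The structure constants of `𝒜₄,₃` in an adapted frame. -/
def structConst (k r s t : ℝ) (i j l : Fin 4) : ℝ :=
  derivMatrix k r s t i l * (if j = 3 then 1 else 0) -
    derivMatrix k r s t j l * (if i = 3 then 1 else 0)

theorem exists_adapted_frame {g : V4 → V4 → ℝ} (hg : IsInnerProduct g) :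
    ∃ (v : Fin 4 → V4) (k r s t : ℝ), IsFrame g v ∧ k ≠ 0 ∧ t ≠ 0 ∧
      ∀ i j, brA43 (v i) (v j) = ∑ l, structConst k r s t i j l • v l := by
  have hzero : ∀ x, g x 0 = 0 := fun x => by simpa using hg.smul_right 0 x 0
  have hzero' : ∀ x, g 0 x = 0 := fun x => by rw [hg.symm, hzero]
  obtain ⟨a, haa, -, ha0, ha⟩ := exists_gram_schmidt_step hg ![0, 0, 0]
    (by simp [Fin.forall_fin_succ, hzero]) (by simp [Fin.forall_fin_succ]) 0
    (by simp [Fin.forall_fin_succ])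
  have ha1 : a 1 = 0 := ha 1 (by decide) (by simp [Fin.forall_fin_succ])
  have ha2 : a 2 = 0 := ha 2 (by decide) (by simp [Fin.forall_fin_succ])
  have ha3 : a 3 = 0 := ha 3 (by decide) (by simp [Fin.forall_fin_succ])
  obtain ⟨b, hbb, hb', hb1, hb⟩ := exists_gram_schmidt_step hg ![a, 0, 0]
    (by simp [Fin.forall_fin_succ, hzero, hzero']) (by simp [Fin.forall_fin_succ, haa]) 1
    (by simp [Fin.forall_fin_succ, ha1])
  have hba : g b a = 0 := hb' 0
  have hb2 : b 2 = 0 := hb 2 (by decide) (by simp [Fin.forall_fin_succ, ha2])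
  have hb3 : b 3 = 0 := hb 3 (by decide) (by simp [Fin.forall_fin_succ, ha3])
  have hab : g a b = 0 := by rw [hg.symm, hba]
  obtain ⟨c, hcc, hc', hc2, hc⟩ := exists_gram_schmidt_step hg ![a, b, 0]
    (by simp [Fin.forall_fin_succ, hzero, hzero', hab, hba])
    (by simp [Fin.forall_fin_succ, haa, hbb]) 2 (by simp [Fin.forall_fin_succ, ha2, hb2])
  have hca : g c a = 0 := hc' 0
  have hcb : g c b = 0 := hc' 1
  have hac : g a c = 0 := by rw [hg.symm, hca]
  have hbc : g b c = 0 := by rw [hg.symm, hcb]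
  have hc3 : c 3 = 0 := hc 3 (by decide) (by simp [Fin.forall_fin_succ, ha3, hb3])
  obtain ⟨d, hdd, hd', hd3, -⟩ := exists_gram_schmidt_step hg ![a, b, c]
    (by simp [Fin.forall_fin_succ, hab, hba, hac, hca, hbc, hcb])
    (by simp [Fin.forall_fin_succ, haa, hbb, hcc]) 3
    (by simp [Fin.forall_fin_succ, ha3, hb3, hc3])
  have hda : g d a = 0 := hd' 0
  have hdb : g d b = 0 := hd' 1
  have hdc : g d c = 0 := hd' 2
  have had : g a d = 0 := by rw [hg.symm, hda]
  have hbd : g b d = 0 := by rw [hg.symm, hdb]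
  have hcd : g c d = 0 := by rw [hg.symm, hdc]
  refine ⟨![a, b, c, d], d 3, b 0 * d 3 / a 0, (c 0 * d 3 - c 2 * d 3 / b 1 * b 0) / a 0,
    c 2 * d 3 / b 1, fun i j => ?_, hd3, by positivity, fun i j => ?_⟩
  · fin_cases i <;> fin_cases j <;> simp [*]
  · ext m
    fin_cases i <;> fin_cases j <;> fin_cases m <;>
      simp [brA43, structConst, derivMatrix, ee, Fin.sum_univ_four, ha1, ha2, ha3, hb2, hb3,
        hc3] <;> field_simp <;> ring

theorem brA43_add_left (x y z : V4) : brA43 (x + y) z = brA43 x z + brA43 y z := by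
  simp only [brA43, Pi.add_apply]; module

theorem brA43_smul_left (a : ℝ) (x y : V4) : brA43 (a • x) y = a • brA43 x y := by
  simp only [brA43, Pi.smul_apply, smul_eq_mul]; module

theorem brA43_add_right (x y z : V4) : brA43 x (y + z) = brA43 x y + brA43 x z := by
  simp only [brA43, Pi.add_apply]; module

theorem brA43_smul_right (a : ℝ) (x y : V4) : brA43 x (a • y) = a • brA43 x y := by
  simp only [brA43, Pi.smul_apply, smul_eq_mul]; module

namespace IsInnerProduct

variable {g : V4 → V4 → ℝ}

theorem koszul_add_left (hg : IsInnerProduct g) (x x' y z : V4) :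
    koszul brA43 g (x + x') y z = koszul brA43 g x y z + koszul brA43 g x' y z := by
  simp only [koszul, brA43_add_left, brA43_add_right, hg.add_left, hg.add_right]; ring

theorem koszul_smul_left (hg : IsInnerProduct g) (a : ℝ) (x y z : V4) :
    koszul brA43 g (a • x) y z = a * koszul brA43 g x y z := by
  simp only [koszul, brA43_smul_left, brA43_smul_right, hg.smul_left, hg.smul_right]; ring

theorem koszul_add_mid (hg : IsInnerProduct g) (x y y' z : V4) :
    koszul brA43 g x (y + y') z = koszul brA43 g x y z + koszul brA43 g x y' z := by
  simp only [koszul, brA43_add_left, brA43_add_right, hg.add_left, hg.add_right]; ring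

theorem koszul_smul_mid (hg : IsInnerProduct g) (a : ℝ) (x y z : V4) :
    koszul brA43 g x (a • y) z = a * koszul brA43 g x y z := by
  simp only [koszul, brA43_smul_left, brA43_smul_right, hg.smul_left, hg.smul_right]; ring

theorem koszul_add_right (hg : IsInnerProduct g) (x y z z' : V4) :
    koszul brA43 g x y (z + z') = koszul brA43 g x y z + koszul brA43 g x y z' := by
  simp only [koszul, brA43_add_left, brA43_add_right, hg.add_left, hg.add_right]; ring

theorem koszul_smul_right (hg : IsInnerProduct g) (a : ℝ) (x y z : V4) :
    koszul brA43 g x y (a • z) = a * koszul brA43 g x y z := by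
  simp only [koszul, brA43_smul_left, brA43_smul_right, hg.smul_left, hg.smul_right]; ring

theorem LC_add_left (hg : IsInnerProduct g) (x x' y : V4) :
    LC brA43 g (x + x') y = LC brA43 g x y + LC brA43 g x' y := by
  ext m
  simp only [LC, hg.koszul_add_left, add_mul, Finset.sum_add_distrib, Pi.add_apply]

theorem LC_smul_left (hg : IsInnerProduct g) (a : ℝ) (x y : V4) : LC brA43 g (a • x) y = a • LC brA43 g x y := by
  ext m
  simp only [LC, hg.koszul_smul_left, mul_assoc, ← Finset.mul_sum, Pi.smul_apply, smul_eq_mul]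

theorem LC_add_right (hg : IsInnerProduct g) (x y y' : V4) :
    LC brA43 g x (y + y') = LC brA43 g x y + LC brA43 g x y' := by
  ext m
  simp only [LC, hg.koszul_add_mid, add_mul, Finset.sum_add_distrib, Pi.add_apply]

theorem LC_smul_right (hg : IsInnerProduct g) (a : ℝ) (x y : V4) : LC brA43 g x (a • y) = a • LC brA43 g x y := by
  ext m
  simp only [LC, hg.koszul_smul_mid, mul_assoc, ← Finset.mul_sum, Pi.smul_apply, smul_eq_mul]

/-- The endomorphism `z ↦ R(z, x) y`. -/
def curvLin (hg : IsInnerProduct g) (x y : V4) : V4 →ₗ[ℝ] V4 where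
  toFun z := curv brA43 g z x y
  map_add' z z' := by
    simp only [curv, hg.LC_add_left, hg.LC_add_right, brA43_add_left]; module
  map_smul' a z := by
    simp only [curv, hg.LC_smul_left, hg.LC_smul_right, brA43_smul_left, RingHom.id_apply]
    module

end IsInnerProduct

namespace IsFrame

variable {g : V4 → V4 → ℝ} {v : Fin 4 → V4}

theorem LC_eq (hg : IsInnerProduct g) (hv : IsFrame g v) (x y : V4) :
    LC brA43 g x y = ∑ a, koszul brA43 g x y (v a) • v a :=
  hv.sum_mul_ginv hg (hg.koszul_add_right x y) fun a z => hg.koszul_smul_right a x y z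

theorem ricci_eq (hg : IsInnerProduct g) (hv : IsFrame g v) (x y : V4) :
    ricci brA43 g x y = ∑ a, g (curv brA43 g (v a) x y) (v a) :=
  hv.trace_eq hg (hg.curvLin x y)

/-- The Ricci tensor in terms of the structure constants of an orthonormal frame. -/
theorem ricci_frame (hg : IsInnerProduct g) (hv : IsFrame g v) {c : Fin 4 → Fin 4 → Fin 4 → ℝ}
    (hc : ∀ i j, brA43 (v i) (v j) = ∑ l, c i j l • v l) {Γ : Fin 4 → Fin 4 → Fin 4 → ℝ}
    (hΓ : ∀ i j l, Γ i j l = (1 / 2) * (c i j l - c j l i + c l i j)) (i j : Fin 4) :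
    ricci brA43 g (v i) (v j) =
      ∑ a, ∑ b, (Γ i j b * Γ a b a - Γ a j b * Γ i b a - c a i b * Γ b j a) := by
  have hk : ∀ i j l, koszul brA43 g (v i) (v j) (v l) = Γ i j l := fun i j l => by
    simp only [koszul, hc, hv.apply_sum hg, hΓ]
  have hLC : ∀ x y a, g (LC brA43 g x y) (v a) = koszul brA43 g x y (v a) := fun x y a => by
    rw [hv.LC_eq hg, hv.apply_sum hg]
  have hLL : ∀ i j l a, g (LC brA43 g (v i) (LC brA43 g (v j) (v l))) (v a) =
      ∑ b, Γ j l b * Γ i b a := fun i j l a => by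
    rw [hLC, hv.LC_eq hg, map_sum_smul (f := fun y => koszul brA43 g (v i) y (v a))
      (fun x y => hg.koszul_add_mid _ x y _) (fun c x => hg.koszul_smul_mid c _ x _)]
    simp only [hk]
  have hbr : ∀ i j l a, g (LC brA43 g (brA43 (v i) (v j)) (v l)) (v a) =
      ∑ b, c i j b * Γ b l a := fun i j l a => by
    rw [hLC, hc, map_sum_smul (f := fun x => koszul brA43 g x (v l) (v a))
      (fun x y => hg.koszul_add_left x y _ _) (fun c x => hg.koszul_smul_left c x _ _)]
    simp only [hk]
  rw [hv.ricci_eq hg]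
  simp only [curv, hg.sub_left, hLL, hbr, Finset.sum_sub_distrib]

theorem ricci_sub_ricci (hg : IsInnerProduct g) (hv : IsFrame g v) {k r s t : ℝ}
    (hc : ∀ i j, brA43 (v i) (v j) = ∑ l, structConst k r s t i j l • v l) :
    ricci brA43 g (v 0) (v 0) - ricci brA43 g (v 3) (v 3) = r ^ 2 + s ^ 2 + t ^ 2 / 2 := by
  rw [hv.ricci_frame hg hc (fun _ _ _ => rfl), hv.ricci_frame hg hc (fun _ _ _ => rfl)]
  simp [Fin.sum_univ_four, structConst, derivMatrix]
  ring

end IsFrame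

/-- A closed 2-form on `𝒜₄,₃` vanishes on the planes spanned by `v 0`, `v 1` and `v 0`, `v 2`. -/
theorem IsAltForm.apply_eq_zero_of_closed {F : V4 → V4 → ℝ} (hF : IsAltForm F)
    (hcl : IsClosedForm brA43 F) {v : Fin 4 → V4} {k r s t : ℝ} (hk : k ≠ 0)
    (hc : ∀ i j, brA43 (v i) (v j) = ∑ l, structConst k r s t i j l • v l) :
    F (v 0) (v 1) = 0 ∧ F (v 0) (v 2) = 0 := by
  have key : ∀ i j l, F (brA43 (v i) (v j)) (v l) =
      ∑ m, structConst k r s t i j m * F (v m) (v l) := fun i j l => by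
    rw [hc, map_sum_smul (f := fun x => F x (v l)) (fun x y => hF.add_left x y _)
      (fun a x => hF.smul_left a x _)]
  have h01 := hcl (v 0) (v 1) (v 3)
  have h02 := hcl (v 0) (v 2) (v 3)
  have h00 : F (v 0) (v 0) = 0 := by linarith [hF.skew (v 0) (v 0)]
  have hs1 := hF.skew (v 1) (v 0)
  simp only [cdiff, key] at h01 h02
  simp [Fin.sum_univ_four, structConst, derivMatrix, h00, hs1] at h01 h02
  have h := h01.resolve_left hk
  exact ⟨h, by simpa [h, hk] using h02⟩


/-- `𝒜₄,₃` admits no left-invariant non-Einstein solution to the Einstein--Maxwell equations. -/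
theorem stmt9 :
    ∀ g F : V4 → V4 → ℝ, IsInnerProduct g → IsAltForm F →
      IsEMSolution (brA43) g F → IsEinstein (brA43) g := by
  intro g F hg hF ⟨hcl, ⟨sF, hs, hscl⟩, hEM⟩
  obtain ⟨v, k, r, s, t, hv, hk, ht, hc⟩ := exists_adapted_frame hg
  exfalso
  obtain ⟨h01, h02⟩ := hF.apply_eq_zero_of_closed hcl hk hc
  obtain ⟨s01, s02⟩ := hs.1.apply_eq_zero_of_closed hscl hk hc
  have h13 : F (v 1) (v 3) = 0 := by
    have h := hv.star_apply hg hF hs 1 3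
    simpa [wedge22, hv _ _, s01, s02, hv.det_mul_sqrt_ne_zero hg] using h
  have h23 : F (v 2) (v 3) = 0 := by
    have h := hv.star_apply hg hF hs 2 3
    simpa [wedge22, hv _ _, s01, s02, hv.det_mul_sqrt_ne_zero hg] using h
  have e0 := hEM (v 0) (v 0)
  have e3 := hEM (v 3) (v 3)
  have hd := hv.ricci_sub_ricci hg hc
  simp only [ricci0, FF0, hv.fhat_fhat hg hF, hv _ _] at e0 e3
  have h0 : F (v 0) (v 0) = 0 := by linarith [hF.skew (v 0) (v 0)]
  have h3 : F (v 3) (v 3) = 0 := by linarith [hF.skew (v 3) (v 3)]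
  have hsum : ∑ a, F (v 0) (v a) ^ 2 = ∑ a, F (v 3) (v a) ^ 2 := by
    simp only [Fin.sum_univ_four, h01, h02, hF.skew (v 3) (v 0), hF.skew (v 3) (v 1),
      hF.skew (v 3) (v 2), h13, h23, h0, h3]
    ring
  rw [hsum] at e0
  have ht2 : 0 < t ^ 2 := by positivity
  have hsq : r ^ 2 + s ^ 2 + t ^ 2 / 2 = 0 := by
    rw [← hd]
    simp only [if_true] at e0 e3
    linarith
  nlinarith [sq_nonneg r, sq_nonneg s]
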